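/- Let σ ∈ ℝ, a ∈ ℝ, let μ > 0 and ν > 0 be non-integers with n = ⌈ν⌉, m = ⌈μ⌉, r = max(m,n), and let f : [a,∞) → ℝ be r-times continuously differentiable, with the limits [D_s^{ν−j} f]_{x=a} := lim_{x→a⁺} D_s^{ν−j} f(x) existing for j = 1, …, n. Then for all x > a, D_s^μ[D_s^ν f](x) = D_s^{μ+ν} f(x) − Σ_{j=1}^n [D_s^{ν−j} f]_{x=a} (x−a)^{−μ−j} e^{−σ(x−a)} / Γ(−μ−j+1), where terms whose argument −μ−j+1 is a nonpositive integer are interpreted as 0 (via 1/Γ = 0 at the poles of Γ). -/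

import Mathlib

open MeasureTheory Set Filter

/-- The fractional substantial integral of order `ν` with lower terminal `a`
(`I_s^0 f = f`). -/
noncomputable def Isub (σ a ν : ℝ) (f : ℝ → ℝ) : ℝ → ℝ :=
  if ν = 0 then f else
    fun x => (1 / Real.Gamma ν) * ∫ τ in a..x, (x - τ) ^ (ν - 1) * Real.exp (-σ * (x - τ)) * f τ

/-- The substantial derivative operator `D_s f = f′ + σ f`. -/
noncomputable def Dsub (σ : ℝ) (f : ℝ → ℝ) : ℝ → ℝ := fun x => deriv f x + σ * f x

/-- The fractional substantial derivative of order `μ`: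
`D_s^μ f = D_s^m [I_s^{m−μ} f]` with `m = ⌈μ⌉`. -/
noncomputable def Dfrac (σ a μ : ℝ) (f : ℝ → ℝ) : ℝ → ℝ :=
  (Dsub σ)^[⌈μ⌉₊] (Isub σ a ((⌈μ⌉₊ : ℝ) - μ) f)

/-- `D_s^γ` for arbitrary real `γ`: the fractional substantial derivative when `γ > 0`,
the identity when `γ = 0`, and the fractional substantial integral `I_s^{−γ}` when `γ < 0`. -/
noncomputable def DIfrac (σ a γ : ℝ) (f : ℝ → ℝ) : ℝ → ℝ :=
  if 0 < γ then Dfrac σ a γ f else Isub σ a (-γ) f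

/-- The Riemann–Liouville integral of order `ν` with lower terminal `a`. -/
noncomputable def rlIntegral (a ν : ℝ) (F : ℝ → ℝ) (x : ℝ) : ℝ :=
  (Real.Gamma ν)⁻¹ * ∫ τ in a..x, (x - τ) ^ (ν - 1) * F τ

lemma intervalIntegrable_rpow_sub_mul {a x ν : ℝ} {F : ℝ → ℝ} (hν : 0 < ν) (hx : a ≤ x)
    (hF : ContinuousOn F (Icc a x)) :
    IntervalIntegrable (fun τ => (x - τ) ^ (ν - 1) * F τ) volume a x := by
  refine IntervalIntegrable.mul_continuousOn ?_ (by rwa [uIcc_of_le hx])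
  have h : IntervalIntegrable (fun t : ℝ => t ^ (ν - 1)) volume (x - a) (x - x) :=
    intervalIntegral.intervalIntegrable_rpow' (by linarith)
  simpa using h.comp_sub_left x

lemma integral_rpow_sub_mul_rpow_sub {α β τ x : ℝ} (hα : 0 < α) (hβ : 0 < β) (hx : τ < x) :
    ∫ s in τ..x, (x - s) ^ (β - 1) * (s - τ) ^ (α - 1) =
      (x - τ) ^ (α + β - 1) * (Real.Gamma α * Real.Gamma β / Real.Gamma (α + β)) := by
  have hd : 0 < x - τ := sub_pos.2 hx
  have h1 : ∫ s in τ..x, (x - s) ^ (β - 1) * (s - τ) ^ (α - 1) =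
      ∫ u in (0 : ℝ)..(x - τ), u ^ (α - 1) * ((x - τ) - u) ^ (β - 1) := by
    have := intervalIntegral.integral_comp_sub_right (a := τ) (b := x)
      (fun u : ℝ => u ^ (α - 1) * ((x - τ) - u) ^ (β - 1)) τ
    rw [sub_self] at this
    rw [← this]
    refine intervalIntegral.integral_congr fun s _ => ?_
    simp only [sub_sub_sub_cancel_right]
    ring
  rw [h1]
  apply Complex.ofReal_injective
  have h2 := Complex.betaIntegral_scaled α β hd
  rw [Complex.betaIntegral_eq_Gamma_mul_div _ _ (by simpa) (by simpa)] at h2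
  rw [← intervalIntegral.integral_ofReal]
  push_cast
  rw [Complex.ofReal_cpow hd.le, ← Complex.Gamma_ofReal, ← Complex.Gamma_ofReal,
    ← Complex.Gamma_ofReal]
  push_cast
  push_cast at h2
  rw [← h2]
  refine intervalIntegral.integral_congr fun u hu => ?_
  rw [uIcc_of_le hd.le] at hu
  rw [Complex.ofReal_cpow hu.1, Complex.ofReal_cpow (by linarith [hu.2])]
  push_cast
  rfl

lemma intervalIntegrable_rpow_sub_mul_rpow_sub {α β τ x : ℝ} (hα : 0 < α) (hβ : 0 < β)
    (hx : τ < x) :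
    IntervalIntegrable (fun s => (x - s) ^ (β - 1) * (s - τ) ^ (α - 1)) volume τ x := by
  apply intervalIntegral.intervalIntegrable_of_integral_ne_zero
  rw [integral_rpow_sub_mul_rpow_sub hα hβ hx]
  have h1 := Real.Gamma_pos_of_pos hα
  have h2 := Real.Gamma_pos_of_pos hβ
  have h3 := Real.Gamma_pos_of_pos (add_pos hα hβ)
  have h4 := Real.rpow_pos_of_pos (sub_pos.2 hx) (α + β - 1)
  positivity

lemma rlIntegral_congr {a ν x : ℝ} {F G : ℝ → ℝ} (hx : a ≤ x) (h : EqOn F G (Ioi a)) :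
    rlIntegral a ν F x = rlIntegral a ν G x := by
  unfold rlIntegral
  congr 1
  refine intervalIntegral.integral_congr_ae (Eventually.of_forall fun τ hτ => ?_)
  rw [uIoc_of_le hx] at hτ
  simp only [h hτ.1]

/-- Riemann–Liouville integral of a power function. -/
lemma rlIntegral_rpow {α β a x : ℝ} (hα : 0 < α) (hβ : 0 < β) (hx : a < x) :
    rlIntegral a β (fun s => (s - a) ^ (α - 1) / Real.Gamma α) x =
      (x - a) ^ (α + β - 1) / Real.Gamma (α + β) := by
  have h1 := (Real.Gamma_pos_of_pos hα).ne'
  have h2 := (Real.Gamma_pos_of_pos hβ).ne'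
  simp only [rlIntegral, ← mul_div_assoc]
  rw [intervalIntegral.integral_div, integral_rpow_sub_mul_rpow_sub hα hβ hx]
  field_simp

/-- The semigroup property of Riemann–Liouville integrals. -/
lemma rlIntegral_rlIntegral {α β a x : ℝ} {F : ℝ → ℝ} (hα : 0 < α) (hβ : 0 < β) (hx : a ≤ x)
    (hF : ContinuousOn F (Icc a x)) :
    rlIntegral a β (rlIntegral a α F) x = rlIntegral a (α + β) F x := by
  have g1 := (Real.Gamma_pos_of_pos hα).ne'
  have g2 := (Real.Gamma_pos_of_pos hβ).ne'
  have g3 := (Real.Gamma_pos_of_pos (add_pos hα hβ)).ne'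
  set μ : Measure ℝ := volume.restrict (Ioo a x) with hμ
  set T : Set (ℝ × ℝ) := {p | p.2 < p.1}
  have hT : MeasurableSet T := measurableSet_lt measurable_snd measurable_fst
  set k : ℝ → ℝ → ℝ := fun s τ => if τ < s then (x - s) ^ (β - 1) * (s - τ) ^ (α - 1) else 0
  have hkm : Measurable (Function.uncurry k) :=
    Measurable.ite hT (by fun_prop) measurable_const
  have hk_left (τ : ℝ) : (fun s => k s τ) =
      (Ioi τ).indicator fun s => (x - s) ^ (β - 1) * (s - τ) ^ (α - 1) := by
    ext s; simp [k, indicator]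
  have hk_nonneg (τ s : ℝ) (hs : s ∈ Ioo a x) : 0 ≤ k s τ := by
    simp only [k]
    split_ifs with h
    · exact mul_nonneg (Real.rpow_nonneg (by linarith [hs.2]) _)
        (Real.rpow_nonneg (by linarith) _)
    · exact le_rfl
  have hinter (τ : ℝ) (hτ : τ ∈ Ioo a x) : Ioo a x ∩ Ioi τ = Ioo τ x := by
    ext s; simp only [mem_inter_iff, mem_Ioo, mem_Ioi] at *
    constructor
    · rintro ⟨h, h'⟩; exact ⟨h', h.2⟩
    · rintro ⟨h, h'⟩; exact ⟨⟨by linarith, h'⟩, h⟩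
  have hk_int (τ : ℝ) (hτ : τ ∈ Ioo a x) : ∫ s, k s τ ∂μ =
      (x - τ) ^ (α + β - 1) * (Real.Gamma α * Real.Gamma β / Real.Gamma (α + β)) := by
    rw [hk_left, hμ, setIntegral_indicator measurableSet_Ioi, hinter τ hτ,
      ← integral_rpow_sub_mul_rpow_sub hα hβ hτ.2, intervalIntegral.integral_of_le hτ.2.le,
      integral_Ioc_eq_integral_Ioo]
  have hk_integrable (τ : ℝ) (hτ : τ ∈ Ioo a x) : Integrable (fun s => k s τ) μ := by
    rw [hk_left, integrable_indicator_iff measurableSet_Ioi, hμ, IntegrableOn,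
      Measure.restrict_restrict measurableSet_Ioi, inter_comm, hinter τ hτ]
    exact ((intervalIntegrable_iff_integrableOn_Ioo_of_le hτ.2.le).1
      (intervalIntegrable_rpow_sub_mul_rpow_sub hα hβ hτ.2))
  have hFm : AEStronglyMeasurable F μ :=
    (hF.mono Ioo_subset_Icc_self).aestronglyMeasurable measurableSet_Ioo
  have hmem : ∀ᵐ τ ∂μ, τ ∈ Ioo a x := ae_restrict_mem measurableSet_Ioo
  have hint : Integrable (Function.uncurry fun s τ => k s τ * F τ) (μ.prod μ) := by
    have hm : AEStronglyMeasurable (Function.uncurry fun s τ => k s τ * F τ) (μ.prod μ) :=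
      hkm.aestronglyMeasurable.mul hFm.comp_snd
    rw [integrable_prod_iff' hm]
    constructor
    · filter_upwards [hmem] with τ hτ
      exact (hk_integrable τ hτ).mul_const (F τ)
    · have h0 : IntervalIntegrable (fun τ => (x - τ) ^ (α + β - 1) * |F τ|) volume a x :=
        intervalIntegrable_rpow_sub_mul (add_pos hα hβ) hx hF.abs
      have h1 := ((intervalIntegrable_iff_integrableOn_Ioo_of_le hx).1 h0).mul_const
        (Real.Gamma α * Real.Gamma β / Real.Gamma (α + β))
      refine h1.congr ?_
      filter_upwards [hmem] with τ hτ
      have : ∫ s, ‖Function.uncurry (fun s τ => k s τ * F τ) (s, τ)‖ ∂μ =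
          ∫ s, k s τ * |F τ| ∂μ := by
        refine integral_congr_ae ?_
        filter_upwards [hmem] with s hs
        simp [Function.uncurry, abs_of_nonneg (hk_nonneg τ s hs)]
      rw [this, integral_mul_const, hk_int τ hτ]
      ring
  have hswap := integral_integral_swap hint
  have hleft : ∫ s, ∫ τ, k s τ * F τ ∂μ ∂μ =
      ∫ s in a..x, (x - s) ^ (β - 1) * ∫ τ in a..s, (s - τ) ^ (α - 1) * F τ := by
    rw [intervalIntegral.integral_of_le hx, integral_Ioc_eq_integral_Ioo]
    refine setIntegral_congr_fun measurableSet_Ioo fun s hs => ?_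
    have : (fun τ => k s τ * F τ) =
        (Iio s).indicator fun τ => (x - s) ^ (β - 1) * ((s - τ) ^ (α - 1) * F τ) := by
      ext τ; simp only [k, indicator, mem_Iio]; split_ifs <;> ring
    have hI : Ioo a x ∩ Iio s = Ioo a s := by
      rw [← Iio_inter_Ioi, inter_right_comm, Iio_inter_Iio, min_eq_right hs.2.le, Iio_inter_Ioi]
    rw [this, hμ, setIntegral_indicator measurableSet_Iio, hI, integral_const_mul,
      intervalIntegral.integral_of_le hs.1.le, integral_Ioc_eq_integral_Ioo]
  have hright : ∫ τ, ∫ s, k s τ * F τ ∂μ ∂μ =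
      (Real.Gamma α * Real.Gamma β / Real.Gamma (α + β)) *
        ∫ τ in a..x, (x - τ) ^ (α + β - 1) * F τ := by
    rw [intervalIntegral.integral_of_le hx, integral_Ioc_eq_integral_Ioo, ← integral_const_mul]
    refine setIntegral_congr_fun measurableSet_Ioo fun τ hτ => ?_
    rw [integral_mul_const, hk_int τ hτ]
    ring
  simp only [rlIntegral]
  have : ∀ s, (x - s) ^ (β - 1) * ((Real.Gamma α)⁻¹ * ∫ τ in a..s, (s - τ) ^ (α - 1) * F τ) =
      (Real.Gamma α)⁻¹ * ((x - s) ^ (β - 1) * ∫ τ in a..s, (s - τ) ^ (α - 1) * F τ) :=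
    fun s => by ring
  simp only [this]
  rw [intervalIntegral.integral_const_mul, ← hleft, hswap, hright]
  field_simp

lemma rlIntegral_self (a ν : ℝ) (F : ℝ → ℝ) : rlIntegral a ν F a = 0 := by
  simp [rlIntegral]

lemma rlIntegral_add {a ν x : ℝ} {F G : ℝ → ℝ}
    (hF : IntervalIntegrable (fun τ => (x - τ) ^ (ν - 1) * F τ) volume a x)
    (hG : IntervalIntegrable (fun τ => (x - τ) ^ (ν - 1) * G τ) volume a x) :
    rlIntegral a ν (fun τ => F τ + G τ) x = rlIntegral a ν F x + rlIntegral a ν G x := by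
  simp only [rlIntegral, mul_add]
  rw [intervalIntegral.integral_add hF hG, mul_add]

lemma rlIntegral_const_mul (a ν x c : ℝ) (F : ℝ → ℝ) :
    rlIntegral a ν (fun τ => c * F τ) x = c * rlIntegral a ν F x := by
  simp only [rlIntegral, mul_left_comm _ c]
  rw [intervalIntegral.integral_const_mul, mul_left_comm]

lemma rlIntegral_eq_integral_unit {a ν x : ℝ} (F : ℝ → ℝ) (hν : 0 < ν) (hx : a ≤ x) :
    rlIntegral a ν F x = (Real.Gamma ν)⁻¹ *
      ((x - a) ^ ν * ∫ s in (0 : ℝ)..1, (1 - s) ^ (ν - 1) * F (a + s * (x - a))) := by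
  rcases hx.eq_or_lt with rfl | hx
  · simp [rlIntegral, Real.zero_rpow hν.ne']
  have hd := sub_pos.2 hx
  rw [rlIntegral]
  congr 1
  have h := intervalIntegral.integral_comp_mul_add (a := 0) (b := 1)
    (fun τ => (x - τ) ^ (ν - 1) * F τ) hd.ne' a
  simp only [mul_zero, zero_add, mul_one, sub_add_cancel, smul_eq_mul] at h
  rw [eq_inv_mul_iff_mul_eq₀ hd.ne'] at h
  rw [← h, ← intervalIntegral.integral_const_mul, ← intervalIntegral.integral_const_mul]
  refine intervalIntegral.integral_congr fun s hs => ?_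
  rw [uIcc_of_le zero_le_one] at hs
  rw [show x - ((x - a) * s + a) = (x - a) * (1 - s) by ring,
    Real.mul_rpow hd.le (by linarith [hs.2]), show (x - a) * s + a = a + s * (x - a) by ring]
  have : (x - a) ^ ν = (x - a) * (x - a) ^ (ν - 1) := by
    rw [Real.rpow_sub_one hd.ne']; field_simp
  rw [this]; ring

lemma continuousOn_rlIntegral {a ν : ℝ} {F : ℝ → ℝ} (hν : 0 < ν)
    (hF : ContinuousOn F (Ici a)) : ContinuousOn (rlIntegral a ν F) (Ici a) := by
  refine ContinuousOn.congr ?_ fun x hx => rlIntegral_eq_integral_unit F hν hx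
  refine continuousOn_const.mul (ContinuousOn.mul ?_ ?_)
  · exact ((continuous_id.sub continuous_const).rpow_const fun _ => Or.inr hν.le).continuousOn
  intro x₀ hx₀
  obtain ⟨C, hC⟩ := isCompact_Icc.exists_bound_of_continuousOn
    (hF.mono (Icc_subset_Ici_self : Icc a (x₀ + 1) ⊆ Ici a))
  have hmaps : ∀ s ∈ Icc (0 : ℝ) 1, ∀ x ∈ Ici a, a + s * (x - a) ∈ Icc a x := by
    intro s hs x hx
    have hx' : 0 ≤ x - a := sub_nonneg.2 hx
    constructor <;> nlinarith [hs.1, hs.2]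
  have hI (x) (hx : x ∈ Ici a) : IntervalIntegrable
      (fun s => (1 - s) ^ (ν - 1) * F (a + s * (x - a))) volume 0 1 := by
    refine intervalIntegrable_rpow_sub_mul hν zero_le_one (hF.comp (by fun_prop) ?_)
    exact fun s hs => (hmaps s hs x hx).1
  refine intervalIntegral.continuousWithinAt_of_dominated_interval
    (bound := fun s => (1 - s) ^ (ν - 1) * C) ?_ ?_ ?_ ?_
  · filter_upwards [self_mem_nhdsWithin] with x hx
    rw [uIoc_of_le zero_le_one]
    exact (hI x hx).1.aestronglyMeasurable
  · filter_upwards [self_mem_nhdsWithin, mem_nhdsWithin_of_mem_nhds (Iic_mem_nhds (lt_add_one x₀))]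
      with x hx hx1
    refine Eventually.of_forall fun s hs => ?_
    rw [uIoc_of_le zero_le_one] at hs
    have hs' : s ∈ Icc (0 : ℝ) 1 := Ioc_subset_Icc_self hs
    have hpos : 0 ≤ (1 - s) ^ (ν - 1) := Real.rpow_nonneg (by linarith [hs.2]) _
    rw [norm_mul, Real.norm_of_nonneg hpos]
    have := hmaps s hs' x hx
    exact mul_le_mul_of_nonneg_left (hC _ ⟨this.1, this.2.trans hx1⟩) hpos
  · exact intervalIntegrable_rpow_sub_mul hν zero_le_one continuousOn_const
  · refine Eventually.of_forall fun s hs => ?_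
    rw [uIoc_of_le zero_le_one] at hs
    refine continuousWithinAt_const.mul ?_
    have hs' : s ∈ Icc (0 : ℝ) 1 := Ioc_subset_Icc_self hs
    exact (hF.comp (by fun_prop) fun x hx => (hmaps s hs' x hx).1 :
      ContinuousOn (fun x => F (a + s * (x - a))) (Ici a)) x₀ hx₀

lemma hasDerivAt_rlIntegral_one {a x : ℝ} {F : ℝ → ℝ} (hF : ContinuousOn F (Ici a))
    (hx : a < x) : HasDerivAt (rlIntegral a 1 F) (F x) x := by
  have h : rlIntegral a 1 F = fun u => ∫ τ in a..u, F τ := by ext u; simp [rlIntegral]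
  rw [h]
  have hc : ContinuousOn F (Ioi a) := hF.mono Ioi_subset_Ici_self
  refine intervalIntegral.integral_hasDerivAt_right ?_
    (hc.stronglyMeasurableAtFilter isOpen_Ioi x hx) (hc.continuousAt (Ioi_mem_nhds hx))
  refine ContinuousOn.intervalIntegrable (hF.mono ?_)
  rw [uIcc_of_le hx.le]
  exact Icc_subset_Ici_self

/-- Raising the order of the integral by one and differentiating recovers the integral. -/
lemma hasDerivAt_rlIntegral_add_one {a ν x : ℝ} {F : ℝ → ℝ} (hν : 0 < ν)
    (hF : ContinuousOn F (Ici a)) (hx : a < x) :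
    HasDerivAt (rlIntegral a (ν + 1) F) (rlIntegral a ν F x) x := by
  refine (hasDerivAt_rlIntegral_one (continuousOn_rlIntegral hν hF) hx).congr_of_eventuallyEq ?_
  filter_upwards [Ioi_mem_nhds hx] with y hy
  exact (rlIntegral_rlIntegral hν one_pos (le_of_lt hy) (hF.mono Icc_subset_Ici_self)).symm

/-- Integration by parts for the Riemann–Liouville integral. -/
lemma rlIntegral_eq_boundary_add {a ν x : ℝ} {F F' : ℝ → ℝ} (hν : 0 < ν)
    (hF : ContinuousOn F (Ici a)) (hF' : ContinuousOn F' (Ici a))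
    (hd : ∀ y > a, HasDerivAt F (F' y) y) (hx : a < x) :
    rlIntegral a ν F x =
      F a * ((x - a) ^ ν / Real.Gamma (ν + 1)) + rlIntegral a (ν + 1) F' x := by
  have hftc : EqOn F (fun y => F a * ((y - a) ^ ((1 : ℝ) - 1) / Real.Gamma 1)
      + rlIntegral a 1 F' y) (Ioi a) := by
    intro y hy
    have hy' : a ≤ y := le_of_lt hy
    have := intervalIntegral.integral_eq_sub_of_hasDerivAt_of_le hy'
      (hF.mono Icc_subset_Ici_self) (fun z hz => hd z hz.1)
      (ContinuousOn.intervalIntegrable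
        (hF'.mono (by rw [uIcc_of_le hy']; exact Icc_subset_Ici_self)))
    simp [rlIntegral, this]
  rw [rlIntegral_congr hx.le hftc, rlIntegral_add, rlIntegral_const_mul,
    rlIntegral_rpow one_pos hν hx, rlIntegral_rlIntegral one_pos hν hx.le
      (hF'.mono Icc_subset_Ici_self), add_comm 1 ν, add_sub_cancel_right]
  · refine intervalIntegrable_rpow_sub_mul hν hx.le ?_
    simp only [sub_self, Real.rpow_zero]
    exact continuousOn_const
  · exact intervalIntegrable_rpow_sub_mul hν hx.le
      ((continuousOn_rlIntegral one_pos hF').mono Icc_subset_Ici_self)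

lemma hasDerivAt_rlIntegral {a ν x : ℝ} {F F' : ℝ → ℝ} (hν : 0 < ν)
    (hF : ContinuousOn F (Ici a)) (hF' : ContinuousOn F' (Ici a))
    (hd : ∀ y > a, HasDerivAt F (F' y) y) (hx : a < x) :
    HasDerivAt (rlIntegral a ν F)
      (F a * ((x - a) ^ (ν - 1) / Real.Gamma ν) + rlIntegral a ν F' x) x := by
  have h1 : HasDerivAt (fun y => F a * ((y - a) ^ ν / Real.Gamma (ν + 1)))
      (F a * ((x - a) ^ (ν - 1) / Real.Gamma ν)) x := by
    have h := ((((hasDerivAt_id x).sub_const a).rpow_const (p := ν)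
      (Or.inl (sub_pos.2 hx).ne')).div_const (Real.Gamma (ν + 1))).const_mul (F a)
    refine h.congr_deriv ?_
    have := (Real.Gamma_pos_of_pos hν).ne'
    rw [Real.Gamma_add_one hν.ne']
    simp only [id]
    field_simp
  refine (h1.add (hasDerivAt_rlIntegral_add_one hν hF' hx)).congr_of_eventuallyEq ?_
  filter_upwards [Ioi_mem_nhds hx] with y hy
  exact rlIntegral_eq_boundary_add hν hF hF' hd hy

lemma Isub_eq_exp_mul_rlIntegral {γ : ℝ} (hγ : 0 < γ) (σ a : ℝ) (f : ℝ → ℝ) (x : ℝ) :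
    Isub σ a γ f x =
      Real.exp (-σ * x) * rlIntegral a γ (fun τ => Real.exp (σ * τ) * f τ) x := by
  rw [Isub, if_neg hγ.ne', rlIntegral, mul_left_comm, one_div,
    ← intervalIntegral.integral_const_mul (Real.exp (-σ * x))]
  congr 1
  refine intervalIntegral.integral_congr fun τ _ => ?_
  simp only [show -σ * (x - τ) = -σ * x + σ * τ by ring, Real.exp_add]
  ring

lemma Dsub_congr {σ a : ℝ} {u v : ℝ → ℝ} (h : EqOn u v (Ioi a)) :
    EqOn (Dsub σ u) (Dsub σ v) (Ioi a) := by
  intro x hx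
  have he : u =ᶠ[nhds x] v := h.eventuallyEq_of_mem (Ioi_mem_nhds hx)
  simp only [Dsub, he.deriv_eq, h hx]

lemma iterate_Dsub_congr {σ a : ℝ} {u v : ℝ → ℝ} (h : EqOn u v (Ioi a)) (k : ℕ) :
    EqOn ((Dsub σ)^[k] u) ((Dsub σ)^[k] v) (Ioi a) := by
  induction k with
  | zero => exact h
  | succ k ih =>
    rw [Function.iterate_succ_apply', Function.iterate_succ_apply']
    exact Dsub_congr ih

/-- `D_s` acts on `e^{-σx} H` as differentiation of `H`. -/
lemma Dsub_exp_mul {σ a : ℝ} {u H H' : ℝ → ℝ}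
    (hu : EqOn u (fun x => Real.exp (-σ * x) * H x) (Ioi a))
    (hH : ∀ x > a, HasDerivAt H (H' x) x) :
    EqOn (Dsub σ u) (fun x => Real.exp (-σ * x) * H' x) (Ioi a) := by
  intro x hx
  rw [Dsub_congr hu hx]
  have h1 : HasDerivAt (fun x => Real.exp (-σ * x)) (Real.exp (-σ * x) * -σ) x := by
    simpa using ((hasDerivAt_id x).const_mul (-σ)).exp
  have h2 : deriv (fun x => Real.exp (-σ * x) * H x) x =
      Real.exp (-σ * x) * -σ * H x + Real.exp (-σ * x) * H' x := (h1.mul (hH x hx)).deriv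
  simp only [Dsub, h2]
  ring

section DerivTower

variable {σ a : ℝ} {f : ℝ → ℝ} {n : ℕ} {G : ℕ → ℝ → ℝ}

lemma iterate_Dsub_Isub {γ : ℝ} (hγ : 0 < γ) (h0 : G 0 = fun τ => Real.exp (σ * τ) * f τ)
    (hc : ∀ k ≤ n, ContinuousOn (G k) (Ici a))
    (hd : ∀ k < n, ∀ y > a, HasDerivAt (G k) (G (k + 1) y) y)
    {k : ℕ} (hk : k ≤ n) (hz : ∀ i < k, G i a = 0) :
    EqOn ((Dsub σ)^[k] (Isub σ a γ f)) (fun x => Real.exp (-σ * x) * rlIntegral a γ (G k) x)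
      (Ioi a) := by
  induction k with
  | zero =>
    intro x _
    simp only [Function.iterate_zero, id, h0, Isub_eq_exp_mul_rlIntegral hγ]
  | succ k ih =>
    rw [Function.iterate_succ_apply']
    refine Dsub_exp_mul (ih (by omega) fun i hi => hz i (by omega)) fun x hx => ?_
    have h := hasDerivAt_rlIntegral hγ (hc k (by omega)) (hc (k + 1) hk) (hd k hk) hx
    rwa [hz k (by omega), zero_mul, zero_add] at h

lemma iterate_succ_Dsub_Isub {γ : ℝ} (hγ : 0 < γ)
    (h0 : G 0 = fun τ => Real.exp (σ * τ) * f τ)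
    (hc : ∀ k ≤ n, ContinuousOn (G k) (Ici a))
    (hd : ∀ k < n, ∀ y > a, HasDerivAt (G k) (G (k + 1) y) y)
    {k : ℕ} (hk : k < n) (hz : ∀ i < k, G i a = 0) :
    EqOn ((Dsub σ)^[k + 1] (Isub σ a γ f)) (fun x => Real.exp (-σ * x) *
      (G k a * ((x - a) ^ (γ - 1) / Real.Gamma γ) + rlIntegral a γ (G (k + 1)) x)) (Ioi a) := by
  rw [Function.iterate_succ_apply']
  exact Dsub_exp_mul (iterate_Dsub_Isub hγ h0 hc hd hk.le hz) fun x hx =>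
    hasDerivAt_rlIntegral hγ (hc k hk.le) (hc (k + 1) hk) (hd k hk) hx

lemma tendsto_rlIntegral_nhdsGT {γ : ℝ} {F : ℝ → ℝ} (hγ : 0 < γ)
    (hF : ContinuousOn F (Ici a)) :
    Tendsto (rlIntegral a γ F) (nhdsWithin a (Ioi a)) (nhds 0) := by
  have h := continuousOn_rlIntegral hγ hF a self_mem_Ici
  rw [ContinuousWithinAt, rlIntegral_self] at h
  exact h.mono_left (nhdsWithin_mono _ Ioi_subset_Ici_self)

/-- If the low-order fractional derivatives have limits at the terminal, then the corresponding
initial values vanish. -/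
lemma eq_zero_of_tendsto_iterate_Dsub {α : ℝ} (hα : 0 < α) (hα1 : α < 1)
    (h0 : G 0 = fun τ => Real.exp (σ * τ) * f τ)
    (hc : ∀ k ≤ n, ContinuousOn (G k) (Ici a))
    (hd : ∀ k < n, ∀ y > a, HasDerivAt (G k) (G (k + 1) y) y)
    (hL : ∀ k < n, ∃ l, Tendsto ((Dsub σ)^[k] (Isub σ a α f))
      (nhdsWithin a (Ioi a)) (nhds l)) (k : ℕ) (hk : k + 1 < n) : G k a = 0 := by
  induction k using Nat.strong_induction_on with
  | _ k ih =>
    obtain ⟨l, hl⟩ := hL (k + 1) hk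
    have heq := iterate_succ_Dsub_Isub hα h0 hc hd (k := k) (by omega)
      fun i hi => ih i hi (by omega)
    have hexp : Tendsto (fun x => Real.exp (σ * x)) (nhdsWithin a (Ioi a))
        (nhds (Real.exp (σ * a))) :=
      (Continuous.tendsto (by fun_prop) a).mono_left nhdsWithin_le_nhds
    have hpow : Tendsto (fun x => (x - a) ^ (1 - α)) (nhdsWithin a (Ioi a)) (nhds 0) := by
      have hcont : Continuous fun x : ℝ => (x - a) ^ (1 - α) :=
        (continuous_id.sub continuous_const).rpow_const fun _ => Or.inr (by linarith)
      have h := hcont.tendsto a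
      simp only [sub_self] at h
      rw [Real.zero_rpow (by linarith)] at h
      exact h.mono_left nhdsWithin_le_nhds
    have hlim := ((hexp.mul hl).sub (tendsto_rlIntegral_nhdsGT hα (hc (k + 1) hk.le))).mul hpow
    rw [mul_zero] at hlim
    have hconst : Tendsto (fun _ : ℝ => G k a / Real.Gamma α) (nhdsWithin a (Ioi a))
        (nhds 0) := by
      refine hlim.congr' ?_
      filter_upwards [self_mem_nhdsWithin] with x hx
      have hxa : 0 < x - a := sub_pos.2 hx
      have h1 : Real.exp (σ * x) * Real.exp (-σ * x) = 1 := by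
        rw [← Real.exp_add]; simp
      have h2 : (x - a) ^ (α - 1) * (x - a) ^ (1 - α) = 1 := by
        rw [← Real.rpow_add hxa]; simp
      rw [heq hx]
      simp only
      rw [← mul_assoc, h1, one_mul, add_sub_cancel_right]
      calc G k a * ((x - a) ^ (α - 1) / Real.Gamma α) * (x - a) ^ (1 - α)
          = G k a / Real.Gamma α * ((x - a) ^ (α - 1) * (x - a) ^ (1 - α)) := by ring
        _ = G k a / Real.Gamma α := by rw [h2, mul_one]
    have h := tendsto_nhds_unique hconst tendsto_const_nhds
    rcases div_eq_zero_iff.1 h.symm with h | h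
    · exact h
    · exact absurd h (Real.Gamma_pos_of_pos hα).ne'

/-- With vanishing initial values, fractional integration commutes past the iterated
substantial derivative. -/
lemma Isub_iterate_Dsub_Isub {α β : ℝ} (hα : 0 < α) (hβ : 0 < β)
    (h0 : G 0 = fun τ => Real.exp (σ * τ) * f τ)
    (hc : ∀ k ≤ n, ContinuousOn (G k) (Ici a))
    (hd : ∀ k < n, ∀ y > a, HasDerivAt (G k) (G (k + 1) y) y)
    {k : ℕ} (hk : k < n) (hz : ∀ i < k, G i a = 0) :
    EqOn (Isub σ a β ((Dsub σ)^[k + 1] (Isub σ a α f)))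
      ((Dsub σ)^[k + 1] (Isub σ a (α + β) f)) (Ioi a) := by
  intro x hx
  have hx' : a < x := hx
  have hg : EqOn (fun τ => Real.exp (σ * τ) * (Dsub σ)^[k + 1] (Isub σ a α f) τ)
      (fun τ => G k a * ((τ - a) ^ (α - 1) / Real.Gamma α) + rlIntegral a α (G (k + 1)) τ)
      (Ioi a) := by
    intro τ hτ
    simp only
    rw [iterate_succ_Dsub_Isub hα h0 hc hd hk hz hτ, ← mul_assoc, ← Real.exp_add]
    simp
  rw [iterate_succ_Dsub_Isub (add_pos hα hβ) h0 hc hd hk hz hx, Isub_eq_exp_mul_rlIntegral hβ,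
    rlIntegral_congr hx'.le hg, rlIntegral_add, rlIntegral_const_mul,
    rlIntegral_rpow hα hβ hx', rlIntegral_rlIntegral hα hβ hx'.le
      ((hc (k + 1) hk).mono Icc_subset_Ici_self)]
  · refine ((intervalIntegrable_rpow_sub_mul_rpow_sub hα hβ hx').const_mul
      (G k a / Real.Gamma α)).congr fun τ _ => ?_
    ring
  · exact intervalIntegrable_rpow_sub_mul hβ hx'.le
      ((continuousOn_rlIntegral hα (hc (k + 1) hk)).mono Icc_subset_Ici_self)

end DerivTower

lemma Dsub_Isub_add_one {σ a γ : ℝ} {f : ℝ → ℝ} (hγ : 0 ≤ γ) (hf : ContinuousOn f (Ici a)) :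
    EqOn (Dsub σ (Isub σ a (γ + 1) f)) (Isub σ a γ f) (Ioi a) := by
  have hF : ContinuousOn (fun τ => Real.exp (σ * τ) * f τ) (Ici a) :=
    ContinuousOn.mul (by fun_prop) hf
  have h1 : EqOn (Isub σ a (γ + 1) f) (fun x => Real.exp (-σ * x) *
      rlIntegral a (γ + 1) (fun τ => Real.exp (σ * τ) * f τ) x) (Ioi a) :=
    fun x _ => Isub_eq_exp_mul_rlIntegral (by linarith) σ a f x
  rcases hγ.eq_or_lt with rfl | hγ
  · intro x hx
    rw [zero_add] at h1
    rw [zero_add, Dsub_exp_mul h1 (fun x hx => hasDerivAt_rlIntegral_one hF hx) hx]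
    simp only [Isub, if_true, ← mul_assoc, ← Real.exp_add]
    simp
  · intro x hx
    rw [Dsub_exp_mul h1 (fun x hx => hasDerivAt_rlIntegral_add_one hγ hF hx) hx,
      Isub_eq_exp_mul_rlIntegral hγ]

lemma ContDiffOn.hasDerivAt_iteratedDerivWithin_Ici {a y : ℝ} {F : ℝ → ℝ} {r k : ℕ}
    (hF : ContDiffOn ℝ r F (Ici a)) (hk : k < r) (hy : a < y) :
    HasDerivAt (iteratedDerivWithin k F (Ici a)) (iteratedDerivWithin (k + 1) F (Ici a) y) y := by
  have h := (hF.differentiableOn_iteratedDerivWithin (m := k) (by exact_mod_cast hk)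
    (uniqueDiffOn_Ici a)) y hy.le
  rw [iteratedDerivWithin_succ]
  exact h.hasDerivWithinAt.hasDerivAt (Ici_mem_nhds hy)

lemma ceil_sub_self_mem_Ioo {ν : ℝ} (hν : 0 < ν) (h : ∀ n : ℤ, ν ≠ n) :
    0 < (⌈ν⌉₊ : ℝ) - ν ∧ (⌈ν⌉₊ : ℝ) - ν < 1 := by
  have h1 := Nat.le_ceil ν
  have h2 := Nat.ceil_lt_add_one hν.le
  have h3 : ν ≠ (⌈ν⌉₊ : ℝ) := by exact_mod_cast h ⌈ν⌉₊
  exact ⟨sub_pos.2 (lt_of_le_of_ne h1 h3), by linarith⟩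

lemma ceil_eq_of_lt_of_le {x : ℝ} {N : ℕ} (h1 : (N : ℝ) < x + 1) (h2 : x ≤ N) (hx : 0 < x) :
    ⌈x⌉₊ = N := by
  have hN : N ≠ 0 := by rintro rfl; simp at h2; linarith
  rw [Nat.ceil_eq_iff hN]
  obtain ⟨M, rfl⟩ := Nat.exists_eq_succ_of_ne_zero hN
  push_cast at *
  exact ⟨by simpa using by linarith, h2⟩

/-- Lemma 2.10: `D_s^μ[D_s^ν f](x) = D_s^{μ+ν} f(x) − Σ_{j=1}^n [D_s^{ν−j} f]_{x=a}
(x−a)^{−μ−j} e^{−σ(x−a)} / Γ(−μ−j+1)` (terms with `−μ−j+1` a nonpositive integer vanish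
since `1/Γ = 0` at the poles of `Γ`). -/
theorem substantial_derivative_composition
    (σ a μ ν : ℝ) (hμ : 0 < μ) (hν : 0 < ν)
    (hμni : ∀ n : ℤ, μ ≠ (n : ℝ)) (hνni : ∀ n : ℤ, ν ≠ (n : ℝ)) (f : ℝ → ℝ)
    (hf : ContDiffOn ℝ ((max ⌈μ⌉₊ ⌈ν⌉₊ : ℕ) : ℕ∞) f (Set.Ici a))
    (L : ℕ → ℝ)
    (hL : ∀ j ∈ Finset.Icc 1 ⌈ν⌉₊,
      Tendsto (DIfrac σ a (ν - (j : ℝ)) f) (nhdsWithin a (Set.Ioi a)) (nhds (L j))) :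
    ∀ x > a, Dfrac σ a μ (Dfrac σ a ν f) x = Dfrac σ a (μ + ν) f x -
      ∑ j ∈ Finset.Icc 1 ⌈ν⌉₊, L j * (x - a) ^ (-μ - (j : ℝ)) *
        Real.exp (-σ * (x - a)) / Real.Gamma (-μ - (j : ℝ) + 1) := by
  intro x hx
  obtain ⟨hα, hα1⟩ := ceil_sub_self_mem_Ioo hν hνni
  obtain ⟨hβ, hβ1⟩ := ceil_sub_self_mem_Ioo hμ hμni
  have hn : 0 < ⌈ν⌉₊ := Nat.ceil_pos.2 hν
  have hm : 0 < ⌈μ⌉₊ := Nat.ceil_pos.2 hμ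
  set n := ⌈ν⌉₊ with hn_def
  set m := ⌈μ⌉₊ with hm_def
  set α := (n : ℝ) - ν with hα_def
  set β := (m : ℝ) - μ with hβ_def
  have hfn : ContDiffOn ℝ n f (Ici a) := hf.of_le (by
    exact_mod_cast le_max_right m n)
  have hF : ContDiffOn ℝ n (fun τ => Real.exp (σ * τ) * f τ) (Ici a) :=
    ContDiffOn.mul (by fun_prop) hfn
  obtain ⟨G, hG⟩ : ∃ G : ℕ → ℝ → ℝ,
    G = fun k => iteratedDerivWithin k (fun τ => Real.exp (σ * τ) * f τ) (Ici a) := ⟨_, rfl⟩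
  have h0 : G 0 = fun τ => Real.exp (σ * τ) * f τ := by rw [hG]; exact iteratedDerivWithin_zero
  have hc : ∀ k ≤ n, ContinuousOn (G k) (Ici a) := fun k hk => by
    rw [hG]
    exact hF.continuousOn_iteratedDerivWithin (by exact_mod_cast hk) (uniqueDiffOn_Ici a)
  have hd : ∀ k < n, ∀ y > a, HasDerivAt (G k) (G (k + 1) y) y := fun k hk y hy => by
    rw [hG]
    exact hF.hasDerivAt_iteratedDerivWithin_Ici hk hy
  have hDI : ∀ j ∈ Finset.Icc 1 n,
      DIfrac σ a (ν - (j : ℝ)) f = (Dsub σ)^[n - j] (Isub σ a α f) := by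
    intro j hj
    rw [Finset.mem_Icc] at hj
    have hcast : ((n - j : ℕ) : ℝ) = n - j := Nat.cast_sub hj.2
    rcases hj.2.lt_or_eq with hjn | rfl
    · have hjn' : (j : ℝ) + 1 ≤ n := by exact_mod_cast hjn
      have hpos : 0 < ν - j := by linarith
      have hceil : ⌈ν - j⌉₊ = n - j :=
        ceil_eq_of_lt_of_le (by rw [hcast]; linarith) (by rw [hcast]; linarith) hpos
      rw [DIfrac, if_pos hpos, Dfrac, hceil, hcast]
      congr 2
      rw [hα_def]; ring
    · rw [DIfrac, if_neg (by linarith), Nat.sub_self, Function.iterate_zero, id, neg_sub]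
  have hz : ∀ k, k + 1 < n → G k a = 0 := by
    refine eq_zero_of_tendsto_iterate_Dsub hα hα1 h0 hc hd fun k hk => ?_
    have hj : n - k ∈ Finset.Icc 1 n := Finset.mem_Icc.2 ⟨by omega, by omega⟩
    have h := hL _ hj
    rw [hDI _ hj, Nat.sub_sub_self hk.le] at h
    exact ⟨_, h⟩
  have hL0 : ∀ j ∈ Finset.Icc 1 n, L j = 0 := by
    intro j hj
    have h := hL j hj
    rw [hDI j hj] at h
    rw [Finset.mem_Icc] at hj
    have heq := iterate_Dsub_Isub hα h0 hc hd (k := n - j) (by omega)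
      fun i hi => hz i (by omega)
    have hexp : Tendsto (fun x => Real.exp (-σ * x)) (nhdsWithin a (Ioi a))
        (nhds (Real.exp (-σ * a))) :=
      (Continuous.tendsto (by fun_prop) a).mono_left nhdsWithin_le_nhds
    have hlim := hexp.mul (tendsto_rlIntegral_nhdsGT hα (hc (n - j) (by omega)))
    rw [mul_zero] at hlim
    exact tendsto_nhds_unique h (hlim.congr' (by
      filter_upwards [self_mem_nhdsWithin] with y hy using (heq hy).symm))
  rw [Finset.sum_eq_zero fun j hj => by rw [hL0 j hj]; simp, sub_zero]
  have hcomp : EqOn (Isub σ a β (Dfrac σ a ν f)) ((Dsub σ)^[n] (Isub σ a (α + β) f)) (Ioi a) := by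
    obtain ⟨p, hp⟩ := Nat.exists_eq_succ_of_ne_zero hn.ne'
    have h := Isub_iterate_Dsub_Isub hα hβ h0 hc hd (k := p) (by omega)
      fun i hi => hz i (by omega)
    rw [← Nat.succ_eq_add_one, ← hp] at h
    exact h
  have hleft : Dfrac σ a μ (Dfrac σ a ν f) x = (Dsub σ)^[m + n] (Isub σ a (α + β) f) x := by
    rw [Function.iterate_add_apply]
    exact iterate_Dsub_congr hcomp m hx
  rw [hleft]
  rcases lt_or_ge (α + β) 1 with hlt | hge
  · have hceil : ⌈μ + ν⌉₊ = m + n :=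
      ceil_eq_of_lt_of_le (by push_cast; linarith) (by push_cast; linarith) (by linarith)
    rw [Dfrac, hceil, show ((m + n : ℕ) : ℝ) - (μ + ν) = α + β by
      rw [hα_def, hβ_def]; push_cast; ring]
  · obtain ⟨N, hN⟩ : ∃ N, m + n = N + 1 := ⟨m + n - 1, by omega⟩
    have hNr : (m : ℝ) + n = N + 1 := by exact_mod_cast hN
    have hceil : ⌈μ + ν⌉₊ = N :=
      ceil_eq_of_lt_of_le (by linarith) (by linarith) (by linarith)
    rw [Dfrac, hceil, hN, Function.iterate_succ_apply,
      show α + β = ((N : ℝ) - (μ + ν)) + 1 by rw [hα_def, hβ_def]; linarith]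
    exact iterate_Dsub_congr (Dsub_Isub_add_one (by linarith) hf.continuousOn) N hx
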